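/- Assume that for all i = 1,…,n one has min(κ_i(u_{i+1}−u_i), κ_{i−1}(u_i−u_{i−1})) + 2d_i ≥ 0. Then the function E is strictly convex on the convex open set Ω; in fact its Hessian D²E(ξ̄) is positive definite at every point ξ̄ ∈ Ω. -/

import Mathlib

open Real Filter Finset

/-- The rescaled Gaussian cumulative distribution function
`F(ξ) = (1/(2√π)) ∫_{-∞}^{ξ} e^{-s²/4} ds`. -/
noncomputable def F (x : ℝ) : ℝ :=
  (1 / (2 * Real.sqrt Real.pi)) * ∫ s in Set.Iio x, Real.exp (-s ^ 2 / 4)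

/-- The derivative `F'(ξ) = (1/(2√π)) e^{-ξ²/4}`. -/
noncomputable def F' (x : ℝ) : ℝ :=
  (1 / (2 * Real.sqrt Real.pi)) * Real.exp (-x ^ 2 / 4)

/-- The functional
`E(ξ̄) = −Σ_{i=0}^{n} k_i(u_{i+1}−u_i) ln(F(ξ_{i+1}/a_i) − F(ξ_i/a_i)) + Σ_{i=1}^{n} d_i ξ_i²/4`,
with the conventions `ξ₀ = −∞`, `ξ_{n+1} = +∞`, i.e. `F(ξ₀/a₀) = 0`, `F(ξ_{n+1}/a_n) = 1`.
Here `ξ : ℕ → ℝ`, only the values `ξ 1, …, ξ n` being relevant. -/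
noncomputable def E (n : ℕ) (u a k d : ℕ → ℝ) (ξ : ℕ → ℝ) : ℝ :=
  -(∑ i ∈ Finset.range (n + 1), k i * (u (i + 1) - u i) *
      Real.log ((if i = n then 1 else F (ξ (i + 1) / a i)) -
        (if i = 0 then 0 else F (ξ i / a i))))
  + ∑ i ∈ Finset.Icc 1 n, d i * ξ i ^ 2 / 4

/-- Reindexing of a point of `ℝⁿ` as the sequence `ξ_1, …, ξ_n` (paper indexing). -/
noncomputable def toSeq (n : ℕ) (x : EuclideanSpace ℝ (Fin n)) : ℕ → ℝ :=
  fun i => if h : i - 1 < n then x ⟨i - 1, h⟩ else 0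

/-- The left-hand side of the `i`-th equation (`1 ≤ i ≤ n`) of the Stefan system:
`d_i ξ_i/2 + k_i(u_{i+1}−u_i) F'(ξ_i/a_i)/(a_i (F(ξ_{i+1}/a_i) − F(ξ_i/a_i)))
 − k_{i−1}(u_i−u_{i−1}) F'(ξ_i/a_{i−1})/(a_{i−1} (F(ξ_i/a_{i−1}) − F(ξ_{i−1}/a_{i−1})))`,
with the conventions `ξ₀ = −∞` (so `F(ξ₀/a₀) = 0`) and `ξ_{n+1} = +∞` (so `F(ξ_{n+1}/a_n) = 1`). -/
noncomputable def stefanLHS (n : ℕ) (u a k d : ℕ → ℝ) (ξ : ℕ → ℝ) (i : ℕ) : ℝ :=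
  d i * ξ i / 2
  + k i * (u (i + 1) - u i) * F' (ξ i / a i) /
      (a i * ((if i = n then 1 else F (ξ (i + 1) / a i)) - F (ξ i / a i)))
  - k (i - 1) * (u i - u (i - 1)) * F' (ξ i / a (i - 1)) /
      (a (i - 1) * (F (ξ i / a (i - 1)) - (if i = 1 then 0 else F (ξ (i - 1) / a (i - 1)))))

section Gaussian

lemma integrable_exp_neg_sq_div_four :
    MeasureTheory.Integrable (fun s : ℝ => Real.exp (-s ^ 2 / 4)) := by
  have h := integrable_exp_neg_mul_sq (b := 1 / 4) (by norm_num)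
  refine h.congr (Eventually.of_forall fun s => ?_)
  simp only
  congr 1
  ring

lemma F_sub_eq_intervalIntegral (x y : ℝ) :
    F y - F x = (1 / (2 * √π)) * ∫ s in x..y, Real.exp (-s ^ 2 / 4) := by
  have h := integrable_exp_neg_sq_div_four
  rw [F, F, ← mul_sub, ← MeasureTheory.integral_Iic_eq_integral_Iio,
    ← MeasureTheory.integral_Iic_eq_integral_Iio,
    intervalIntegral.integral_Iic_sub_Iic h.integrableOn h.integrableOn]

lemma hasDerivAt_F (x : ℝ) : HasDerivAt F (F' x) x := by
  have hc : Continuous fun s : ℝ => Real.exp (-s ^ 2 / 4) := by fun_prop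
  have h := (intervalIntegral.integral_hasDerivAt_right (hc.intervalIntegrable 0 x)
    (hc.stronglyMeasurableAtFilter _ _) hc.continuousAt).const_mul (1 / (2 * √π))
  have h2 := h.const_add (F 0)
  refine h2.congr_of_eventuallyEq (Eventually.of_forall fun y => ?_)
  simp only
  linarith [F_sub_eq_intervalIntegral 0 y]

lemma hasDerivAt_F' (x : ℝ) : HasDerivAt F' (-x / 2 * F' x) x := by
  have h : HasDerivAt (fun y : ℝ => -y ^ 2 / 4) (-x / 2) x := by
    have := ((hasDerivAt_pow 2 x).neg.div_const 4)
    refine this.congr_deriv ?_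
    norm_num
    ring
  refine ((h.exp).const_mul (1 / (2 * √π))).congr_deriv ?_
  rw [F']
  ring

lemma F'_pos (x : ℝ) : 0 < F' x := by
  unfold F'
  positivity

lemma F'_neg (x : ℝ) : F' (-x) = F' x := by
  simp [F']

lemma F_strictMono : StrictMono F :=
  strictMono_of_deriv_pos fun x => by rw [(hasDerivAt_F x).deriv]; exact F'_pos x

lemma F_neg (x : ℝ) : F (-x) = 1 - F x := by
  have h := integrable_exp_neg_sq_div_four
  have htot : ∫ s : ℝ, Real.exp (-s ^ 2 / 4) = 2 * √π := by
    have h1 := integral_gaussian (1 / 4)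
    have h2 : √(π / (1 / 4)) = 2 * √π := by
      rw [show π / (1 / 4) = 2 ^ 2 * π by ring, Real.sqrt_mul (by norm_num),
        Real.sqrt_sq (by norm_num)]
    rw [← h2, ← h1]
    congr 1
    ext s
    congr 1
    ring
  have hsplit := intervalIntegral.integral_Iic_add_Ioi (b := x) h.integrableOn h.integrableOn
  have hrefl := integral_comp_neg_Iic (-x) fun s : ℝ => Real.exp (-s ^ 2 / 4)
  simp only [neg_neg, neg_sq] at hrefl
  rw [F, F, ← MeasureTheory.integral_Iic_eq_integral_Iio,
    ← MeasureTheory.integral_Iic_eq_integral_Iio, hrefl, ← sub_eq_iff_eq_add'.2 hsplit.symm, htot]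
  have : 0 < √π := Real.sqrt_pos.2 Real.pi_pos
  field_simp

lemma F_pos (x : ℝ) : 0 < F x := by
  have h : 0 ≤ F (x - 1) := by
    unfold F
    refine mul_nonneg (by positivity) (MeasureTheory.integral_nonneg fun s => ?_)
    positivity
  exact h.trans_lt (F_strictMono (by linarith))

lemma F_lt_one (x : ℝ) : F x < 1 := by
  have := F_pos (-x)
  rw [F_neg] at this
  linarith

lemma tendsto_F_atTop : Tendsto F atTop (nhds 1) := by
  have h := integrable_exp_neg_sq_div_four
  have h1 := ((MeasureTheory.intervalIntegral_tendsto_integral_Ioi 0 h.integrableOn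
    tendsto_id).const_mul (1 / (2 * √π))).const_add (F 0)
  have hlim : F 0 + 1 / (2 * √π) * ∫ s in Set.Ioi (0 : ℝ), Real.exp (-s ^ 2 / 4) = 1 := by
    have hrefl := integral_comp_neg_Iic 0 fun s : ℝ => Real.exp (-s ^ 2 / 4)
    simp only [neg_zero, neg_sq, MeasureTheory.integral_Iic_eq_integral_Iio] at hrefl
    rw [← hrefl]
    have := F_neg 0
    rw [neg_zero] at this
    change F 0 + F 0 = 1
    linarith
  rw [hlim] at h1
  refine h1.congr fun y => ?_
  have := F_sub_eq_intervalIntegral 0 y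
  simp only [id]
  linarith

/-- Birnbaum's bound for the Gaussian tail. -/
lemma one_sub_F_lt {x : ℝ} (hx : 0 ≤ x) : 1 - F x < F' x * (√(x ^ 2 + 4) - x) := by
  let R : ℝ → ℝ := fun x => F' x * (√(x ^ 2 + 4) - x) - (1 - F x)
  have hR : ∀ y, HasDerivAt R (-y / 2 * F' y * (√(y ^ 2 + 4) - y)
      + F' y * (2 * y / (2 * √(y ^ 2 + 4)) - 1) + F' y) y := by
    intro y
    have h1 : HasDerivAt (fun y : ℝ => y ^ 2 + 4) (2 * y) y := by
      simpa using (hasDerivAt_pow 2 y).add_const 4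
    have h2 := (h1.sqrt (by positivity)).sub (hasDerivAt_id y)
    have h3 := ((hasDerivAt_F' y).mul h2).sub ((hasDerivAt_F y).const_sub 1)
    refine h3.congr_deriv ?_
    simp only [Pi.sub_apply, id]
    ring
  have hanti : StrictAntiOn R (Set.Ici 0) := by
    refine strictAntiOn_of_deriv_neg (convex_Ici 0)
      (fun y _ => (hR y).continuousAt.continuousWithinAt) fun y hy => ?_
    rw [interior_Ici, Set.mem_Ioi] at hy
    rw [(hR y).deriv]
    have hs : 0 < √(y ^ 2 + 4) := by positivity
    have hs2 : √(y ^ 2 + 4) ^ 2 = y ^ 2 + 4 := Real.sq_sqrt (by positivity)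
    set s := √(y ^ 2 + 4)
    have hkey : y * s < y ^ 2 + 2 := by
      refine lt_of_pow_lt_pow_left₀ 2 (by positivity) ?_
      rw [mul_pow, hs2]
      nlinarith
    have heq : -y / 2 * F' y * (s - y) + F' y * (2 * y / (2 * s) - 1) + F' y
        = -(F' y * y / (2 * s) * (s ^ 2 - s * y - 2)) := by
      field_simp
      ring
    rw [heq, hs2, neg_lt_zero]
    have := F'_pos y
    have h5 : 0 < y ^ 2 + 4 - s * y - 2 := by linarith
    positivity
  have hnonneg : 0 ≤ R (x + 1) := by
    have hlim : Tendsto (fun z => -(1 - F z)) atTop (nhds 0) := by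
      simpa using (tendsto_F_atTop.const_sub 1).neg
    refine le_of_tendsto hlim ?_
    filter_upwards [eventually_ge_atTop (x + 1)] with z hz
    have h1 : R z ≤ R (x + 1) :=
      hanti.antitoneOn (by simp only [Set.mem_Ici]; linarith)
        (by simp only [Set.mem_Ici]; linarith) hz
    have h2 : z ≤ √(z ^ 2 + 4) := Real.le_sqrt_of_sq_le (by linarith)
    have h3 : 0 ≤ F' z * (√(z ^ 2 + 4) - z) :=
      mul_nonneg (F'_pos z).le (by linarith)
    have h4 : R z = F' z * (√(z ^ 2 + 4) - z) - (1 - F z) := rfl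
    linarith
  have hlt : R (x + 1) < R x :=
    hanti (by simpa using hx) (by simp only [Set.mem_Ici]; linarith) (by linarith)
  have h4 : R x = F' x * (√(x ^ 2 + 4) - x) - (1 - F x) := rfl
  linarith

lemma tail_quadratic_pos {x : ℝ} (hx : 0 ≤ x) :
    0 < F' x ^ 2 - x / 2 * F' x * (1 - F x) - (1 - F x) ^ 2 / 4 := by
  have h := one_sub_F_lt hx
  have hp := F'_pos x
  have hG : 0 < 1 - F x := by linarith [F_lt_one x]
  set G := 1 - F x
  have hs2 : √(x ^ 2 + 4) ^ 2 = x ^ 2 + 4 := Real.sq_sqrt (by positivity)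
  have hs : 0 < √(x ^ 2 + 4) := by positivity
  set s := √(x ^ 2 + 4)
  have h1 : G + F' x * x < F' x * s := by linarith
  have h2 : (G + F' x * x) ^ 2 < (F' x * s) ^ 2 :=
    pow_lt_pow_left₀ h1 (by positivity) two_ne_zero
  rw [mul_pow, hs2] at h2
  nlinarith

lemma gap_discriminant_pos {x y : ℝ} (hx : 0 ≤ x) (hxy : x < y) :
    0 < F' x ^ 2 * y - (x * F' x + (F y - F x) / 2) * (F' y + y / 2 * (F y - F x)) := by
  let S : ℝ → ℝ := fun z => F' z + z / 2 * (F z - F x)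
  let J : ℝ → ℝ := fun z => F' x ^ 2 * (z / S z) - (x * F' x + (F z - F x) / 2)
  have hFnn : ∀ z, x ≤ z → 0 ≤ F z - F x := fun z hz => by
    linarith [F_strictMono.monotone hz]
  have hSpos : ∀ z, x ≤ z → 0 < S z := fun z hz =>
    add_pos_of_pos_of_nonneg (F'_pos z) (mul_nonneg (by linarith) (hFnn z hz))
  have hS : ∀ z, HasDerivAt S ((F z - F x) / 2) z := fun z => by
    have h := (hasDerivAt_F' z).add
      (((hasDerivAt_id z).div_const 2).mul ((hasDerivAt_F z).sub_const (F x)))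
    refine h.congr_deriv ?_
    simp only [id]
    ring
  have hJ : ∀ z, x ≤ z → HasDerivAt J (F' z * (F' x ^ 2 / S z ^ 2 - 1 / 2)) z := fun z hz => by
    have h := (((hasDerivAt_id z).div (hS z) (hSpos z hz).ne').const_mul (F' x ^ 2)).sub
      ((((hasDerivAt_F z).sub_const (F x)).div_const 2).const_add (x * F' x))
    refine h.congr_deriv ?_
    have := (hSpos z hz).ne'
    have hz : S z = F' z + z / 2 * (F z - F x) := rfl
    simp only [id]
    field_simp
    rw [hz]
    ring
  have hSmono : StrictMonoOn S (Set.Ici x) := by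
    refine strictMonoOn_of_deriv_pos (convex_Ici x)
      (fun z _ => (hS z).continuousAt.continuousWithinAt) fun z hz => ?_
    rw [interior_Ici, Set.mem_Ioi] at hz
    rw [(hS z).deriv]
    linarith [F_strictMono hz]
  suffices hJy : 0 < J y by
    have hz : S y = F' y + y / 2 * (F y - F x) := rfl
    have h1 := mul_pos hJy (hSpos y hxy.le)
    have h2 : J y * S y = F' x ^ 2 * y - (x * F' x + (F y - F x) / 2) * S y := by
      have := (hSpos y hxy.le).ne'
      simp only [J]
      field_simp
    rwa [h2, hz] at h1
  rcases le_or_gt (S y ^ 2) (2 * F' x ^ 2) with hcase | hcase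
  · have hJx : J x = 0 := by
      have := (F'_pos x).ne'
      simp only [J, S, sub_self, mul_zero, add_zero, zero_div]
      field_simp
      ring
    have hmono : StrictMonoOn J (Set.Icc x y) := by
      refine strictMonoOn_of_deriv_pos (convex_Icc x y)
        (fun z hz => (hJ z hz.1).continuousAt.continuousWithinAt) fun z hz => ?_
      rw [interior_Icc] at hz
      rw [(hJ z hz.1.le).deriv]
      refine mul_pos (F'_pos z) ?_
      have h1 : S z < S y := hSmono hz.1.le hxy.le hz.2
      have h2 : S z ^ 2 < S y ^ 2 :=
        pow_lt_pow_left₀ h1 (hSpos z hz.1.le).le two_ne_zero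
      rw [sub_pos, div_lt_div_iff₀ two_pos (pow_pos (hSpos z hz.1.le) 2)]
      linarith
    rw [← hJx]
    exact hmono ⟨le_rfl, hxy.le⟩ ⟨hxy.le, le_rfl⟩ hxy
  · have hanti : AntitoneOn J (Set.Ici y) := by
      refine antitoneOn_of_deriv_nonpos (convex_Ici y)
        (fun z hz => (hJ z (hxy.le.trans hz)).continuousAt.continuousWithinAt)
        (fun z hz => ?_) fun z hz => ?_
      · rw [interior_Ici, Set.mem_Ioi] at hz
        exact (hJ z (hxy.trans hz).le).differentiableAt.differentiableWithinAt
      · rw [interior_Ici, Set.mem_Ioi] at hz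
        have hxz : x ≤ z := (hxy.trans hz).le
        rw [(hJ z hxz).deriv]
        refine mul_nonpos_of_nonneg_of_nonpos (F'_pos z).le ?_
        have h1 : S y < S z := hSmono hxy.le hxz hz
        have h2 : S y ^ 2 < S z ^ 2 :=
          pow_lt_pow_left₀ h1 (hSpos y hxy.le).le two_ne_zero
        rw [sub_nonpos, div_le_div_iff₀ (pow_pos (hSpos z hxz) 2) two_pos]
        linarith
    have hG : 0 < 1 - F x := by linarith [F_lt_one x]
    have hSlim : Tendsto (fun z => F' z / z + (F z - F x) / 2) atTop
        (nhds (0 + (1 - F x) / 2)) := by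
      refine Tendsto.add ?_ ((tendsto_F_atTop.sub_const _).div_const 2)
      refine tendsto_bdd_div_atTop_nhds_zero (b := 0) (B := 1 / (2 * √π))
        (Eventually.of_forall fun z => (F'_pos z).le) (Eventually.of_forall fun z => ?_) tendsto_id
      refine mul_le_of_le_one_right (by positivity) (Real.exp_le_one_iff.2 ?_)
      have := sq_nonneg z
      linarith
    have hJlim : Tendsto J atTop
        (nhds (F' x ^ 2 * (0 + (1 - F x) / 2)⁻¹ - (x * F' x + (1 - F x) / 2))) := by
      have h1 := ((hSlim.inv₀ (by positivity)).const_mul (F' x ^ 2)).sub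
        (((tendsto_F_atTop.sub_const (F x)).div_const 2).const_add (x * F' x))
      refine h1.congr' ?_
      filter_upwards [eventually_gt_atTop y] with z hz
      have hz0 : 0 < z := by linarith
      have hzx := (hSpos z (hxy.trans hz).le).ne'
      have hSz : F' z / z + (F z - F x) / 2 = S z / z := by
        simp only [S]
        field_simp
      simp only [J]
      rw [hSz, inv_div]
    refine lt_of_lt_of_le ?_ (le_of_tendsto hJlim ?_ (b := J y))
    · have := tail_quadratic_pos hx
      rw [zero_add]
      have h : F' x ^ 2 * ((1 - F x) / 2)⁻¹ - (x * F' x + (1 - F x) / 2)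
          = 2 / (1 - F x) * (F' x ^ 2 - x / 2 * F' x * (1 - F x) - (1 - F x) ^ 2 / 4) := by
        field_simp
        ring
      rw [h]
      positivity
    · filter_upwards [eventually_ge_atTop y] with z hz
      exact hanti (Set.mem_Ici.2 le_rfl) hz hz

lemma form_pos_of_nonneg {x y : ℝ} (hx : 0 ≤ x) (hxy : x < y) {w v : ℝ} (hwv : w ≠ 0 ∨ v ≠ 0) :
    (F y - F x) ^ 2 / 4 * w ^ 2 < (F' y * v - F' x * w) ^ 2
      - (-y / 2 * F' y * v ^ 2 - -x / 2 * F' x * w ^ 2) * (F y - F x) := by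
  have hD := gap_discriminant_pos hx hxy
  have hG : 0 < F y - F x := by linarith [F_strictMono hxy]
  have hp := F'_pos x
  have hq := F'_pos y
  set p := F' x
  set q := F' y
  set G := F y - F x
  have hC : 0 < q * (q + y / 2 * G) := by
    have : 0 < y := by linarith
    positivity
  set C := q * (q + y / 2 * G) with hCdef
  rw [← sub_pos]
  refine pos_of_mul_pos_right ?_ hC.le
  have key : C * ((q * v - p * w) ^ 2 - (-y / 2 * q * v ^ 2 - -x / 2 * p * w ^ 2) * G
      - G ^ 2 / 4 * w ^ 2) = (C * v - p * q * w) ^ 2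
      + q * G / 2 * (p ^ 2 * y - (x * p + G / 2) * (q + y / 2 * G)) * w ^ 2 := by
    rw [hCdef]
    ring
  rw [key]
  by_cases hw : w = 0
  · have hv : v ≠ 0 := hwv.resolve_left (not_not.2 hw)
    rw [hw]
    have : 0 < (C * v) ^ 2 := by positivity
    simpa using this
  · have : 0 < q * G / 2 * (p ^ 2 * y - (x * p + G / 2) * (q + y / 2 * G)) * w ^ 2 := by
      positivity
    have := sq_nonneg (C * v - p * q * w)
    linarith

/-- Lower bound for the Hessian of `-log (F y - F x)`. -/
lemma form_pos {x y : ℝ} (hxy : x < y) {w v : ℝ} (hwv : w ≠ 0 ∨ v ≠ 0) :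
    (F y - F x) ^ 2 / 4 * ((if 0 ≤ x then w ^ 2 else 0) + (if y < 0 then v ^ 2 else 0)) <
      (F' y * v - F' x * w) ^ 2
      - (-y / 2 * F' y * v ^ 2 - -x / 2 * F' x * w ^ 2) * (F y - F x) := by
  rcases le_or_gt 0 x with hx | hx
  · rw [if_pos hx, if_neg (by linarith), add_zero]
    exact form_pos_of_nonneg hx hxy hwv
  rcases lt_or_ge y 0 with hy | hy
  · rw [if_neg hx.not_ge, if_pos hy, zero_add]
    have h := form_pos_of_nonneg (x := -y) (y := -x) (by linarith) (by linarith) hwv.symm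
    simp only [F_neg, F'_neg] at h
    refine lt_of_eq_of_lt ?_ (lt_of_lt_of_eq h ?_) <;> ring
  rw [if_neg hx.not_ge, if_neg hy.not_gt, add_zero, mul_zero]
  have hG : 0 < F y - F x := by linarith [F_strictMono hxy]
  have hp := F'_pos x
  have hq := F'_pos y
  have key : (F' y * v - F' x * w) ^ 2
      - (-y / 2 * F' y * v ^ 2 - -x / 2 * F' x * w ^ 2) * (F y - F x)
      = (F' y * v - F' x * w) ^ 2 + y / 2 * F' y * (F y - F x) * v ^ 2
        + -x / 2 * F' x * (F y - F x) * w ^ 2 := by ring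
  rw [key]
  have h2 : 0 ≤ y / 2 * F' y * (F y - F x) * v ^ 2 := by positivity
  have hx' : 0 < -x := by linarith
  by_cases hw : w = 0
  · have hv : v ≠ 0 := hwv.resolve_left (not_not.2 hw)
    rw [hw] at *
    have : 0 < (F' y * v) ^ 2 := by positivity
    simp only [mul_zero, sub_zero, ne_eq, OfNat.ofNat_ne_zero, not_false_eq_true, zero_pow,
      add_zero]
    linarith
  · have h3 : 0 < -x / 2 * F' x * (F y - F x) * w ^ 2 := by positivity
    have := sq_nonneg (F' y * v - F' x * w)
    linarith

/-- Lower bound for the second derivative of `-log (1 - F x)`. -/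
lemma tail_form_pos (x : ℝ) {w : ℝ} (hw : w ≠ 0) :
    (1 - F x) ^ 2 / 4 * (if 0 ≤ x then w ^ 2 else 0) <
      (F' x * w) ^ 2 + -x / 2 * F' x * w ^ 2 * (1 - F x) := by
  have hG : 0 < 1 - F x := by linarith [F_lt_one x]
  have hp := F'_pos x
  rcases le_or_gt 0 x with hx | hx
  · rw [if_pos hx]
    have h := mul_pos (tail_quadratic_pos hx) (pow_pos (abs_pos.2 hw) 2)
    rw [sq_abs] at h
    nlinarith
  · rw [if_neg hx.not_ge, mul_zero]
    have hx' : 0 < -x := by linarith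
    positivity

/-- Lower bound for the second derivative of `-log (F y)`. -/
lemma head_form_pos (y : ℝ) {v : ℝ} (hv : v ≠ 0) :
    F y ^ 2 / 4 * (if y < 0 then v ^ 2 else 0) <
      (F' y * v) ^ 2 - -y / 2 * F' y * v ^ 2 * F y := by
  have hp := F'_pos y
  have hG := F_pos y
  rcases lt_or_ge y 0 with hy | hy
  · have h := tail_form_pos (-y) hv
    rw [if_pos (by linarith)] at h
    simp only [F_neg, F'_neg] at h
    rw [if_pos hy]
    refine lt_of_eq_of_lt ?_ (lt_of_lt_of_eq h ?_) <;> ring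
  · rw [if_neg hy.not_gt, mul_zero]
    have h1 : 0 < (F' y * v) ^ 2 := by positivity
    have h2 : 0 ≤ y / 2 * F' y * v ^ 2 * F y := by positivity
    linarith

end Gaussian

section Lines

/-- The argument of the `i`-th logarithm in `E`. -/
noncomputable def gap (n : ℕ) (a ξ : ℕ → ℝ) (i : ℕ) : ℝ :=
  (if i = n then 1 else F (ξ (i + 1) / a i)) - (if i = 0 then 0 else F (ξ i / a i))

/-- The derivative of `gap` at `ξ` in the direction `ω`. -/
noncomputable def gapDeriv (n : ℕ) (a ξ ω : ℕ → ℝ) (i : ℕ) : ℝ :=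
  (if i = n then 0 else F' (ξ (i + 1) / a i) * (ω (i + 1) / a i)) -
    (if i = 0 then 0 else F' (ξ i / a i) * (ω i / a i))

/-- The second derivative of `gap` at `ξ` in the direction `ω`. -/
noncomputable def gapDeriv2 (n : ℕ) (a ξ ω : ℕ → ℝ) (i : ℕ) : ℝ :=
  (if i = n then 0 else
    -(ξ (i + 1) / a i) / 2 * F' (ξ (i + 1) / a i) * (ω (i + 1) / a i) ^ 2) -
    (if i = 0 then 0 else -(ξ i / a i) / 2 * F' (ξ i / a i) * (ω i / a i) ^ 2)

/-- The derivative of `E` at `ξ` in the direction `ω`. -/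
noncomputable def dirDeriv (n : ℕ) (u a k d ξ ω : ℕ → ℝ) : ℝ :=
  -(∑ i ∈ Finset.range (n + 1), k i * (u (i + 1) - u i) * (gapDeriv n a ξ ω i / gap n a ξ i))
  + ∑ i ∈ Finset.Icc 1 n, d i * ξ i * ω i / 2

/-- The second derivative of `E` at `ξ` in the direction `ω`. -/
noncomputable def dirDeriv2 (n : ℕ) (u a k d ξ ω : ℕ → ℝ) : ℝ :=
  -(∑ i ∈ Finset.range (n + 1), k i * (u (i + 1) - u i) *
      ((gapDeriv2 n a ξ ω i * gap n a ξ i - gapDeriv n a ξ ω i * gapDeriv n a ξ ω i)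
        / gap n a ξ i ^ 2))
  + ∑ i ∈ Finset.Icc 1 n, d i * ω i ^ 2 / 2

variable {n : ℕ} {u a k d ξ ω : ℕ → ℝ}

lemma gap_pos (hn : 1 ≤ n) (ha : ∀ i ≤ n, 0 < a i)
    (hξ : ∀ i, 1 ≤ i → i < n → ξ i < ξ (i + 1)) {i : ℕ} (hi : i ≤ n) : 0 < gap n a ξ i := by
  unfold gap
  split_ifs with h1 h2 h2
  · omega
  · linarith [F_lt_one (ξ i / a i)]
  · linarith [F_pos (ξ (i + 1) / a i)]
  · rw [sub_pos]
    exact F_strictMono (div_lt_div_of_pos_right (hξ i (by omega) (by omega)) (ha i hi))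

lemma hasDerivAt_add_mul_div (p q c t : ℝ) :
    HasDerivAt (fun t : ℝ => (p + t * q) / c) (q / c) t := by
  simpa using (((hasDerivAt_id t).mul_const q).const_add p).div_const c

lemma hasDerivAt_gap (i : ℕ) (t : ℝ) :
    HasDerivAt (fun t => gap n a (fun j => ξ j + t * ω j) i)
      (gapDeriv n a (fun j => ξ j + t * ω j) ω i) t := by
  unfold gap gapDeriv
  have h : ∀ j, HasDerivAt (fun t => F ((ξ j + t * ω j) / a i))
      (F' ((ξ j + t * ω j) / a i) * (ω j / a i)) t := fun j =>
    (hasDerivAt_F _).comp t (hasDerivAt_add_mul_div _ _ _ _)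
  refine HasDerivAt.sub ?_ ?_
  · split_ifs
    · exact hasDerivAt_const _ _
    · exact h _
  · split_ifs
    · exact hasDerivAt_const _ _
    · exact h _

lemma hasDerivAt_gapDeriv (i : ℕ) (t : ℝ) :
    HasDerivAt (fun t => gapDeriv n a (fun j => ξ j + t * ω j) ω i)
      (gapDeriv2 n a (fun j => ξ j + t * ω j) ω i) t := by
  unfold gapDeriv gapDeriv2
  have h : ∀ j, HasDerivAt (fun t => F' ((ξ j + t * ω j) / a i) * (ω j / a i))
      (-((ξ j + t * ω j) / a i) / 2 * F' ((ξ j + t * ω j) / a i) * (ω j / a i) ^ 2) t := by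
    intro j
    refine (((hasDerivAt_F' _).comp t (hasDerivAt_add_mul_div (ξ j) (ω j) (a i) t)).mul_const
      (ω j / a i)).congr_deriv ?_
    ring
  refine HasDerivAt.sub ?_ ?_
  · split_ifs
    · exact hasDerivAt_const _ _
    · exact h _
  · split_ifs
    · exact hasDerivAt_const _ _
    · exact h _

lemma hasDerivAt_E (hn : 1 ≤ n) (ha : ∀ i ≤ n, 0 < a i) {t : ℝ}
    (hξ : ∀ i, 1 ≤ i → i < n → ξ i + t * ω i < ξ (i + 1) + t * ω (i + 1)) :
    HasDerivAt (fun t => E n u a k d (fun j => ξ j + t * ω j))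
      (dirDeriv n u a k d (fun j => ξ j + t * ω j) ω) t := by
  refine HasDerivAt.add (HasDerivAt.neg (HasDerivAt.fun_sum fun i hi => ?_))
    (HasDerivAt.fun_sum fun i _ => ?_)
  · have hg := gap_pos hn ha hξ (Nat.lt_succ_iff.1 (Finset.mem_range.1 hi))
    exact ((hasDerivAt_gap i t).log hg.ne').const_mul _
  · have h : HasDerivAt (fun t : ℝ => ξ i + t * ω i) (ω i) t := by
      simpa using hasDerivAt_add_mul_div (ξ i) (ω i) 1 t
    refine (((h.pow 2).const_mul (d i)).div_const 4).congr_deriv ?_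
    norm_num
    ring

lemma hasDerivAt_dirDeriv (hn : 1 ≤ n) (ha : ∀ i ≤ n, 0 < a i) {t : ℝ}
    (hξ : ∀ i, 1 ≤ i → i < n → ξ i + t * ω i < ξ (i + 1) + t * ω (i + 1)) :
    HasDerivAt (fun t => dirDeriv n u a k d (fun j => ξ j + t * ω j) ω)
      (dirDeriv2 n u a k d (fun j => ξ j + t * ω j) ω) t := by
  refine HasDerivAt.add (HasDerivAt.neg (HasDerivAt.fun_sum fun i hi => ?_))
    (HasDerivAt.fun_sum fun i _ => ?_)
  · have hg := gap_pos hn ha hξ (Nat.lt_succ_iff.1 (Finset.mem_range.1 hi))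
    exact ((hasDerivAt_gapDeriv i t).div (hasDerivAt_gap i t) hg.ne').const_mul _
  · have h : HasDerivAt (fun t : ℝ => ξ i + t * ω i) (ω i) t := by
      simpa using hasDerivAt_add_mul_div (ξ i) (ω i) 1 t
    refine (((h.const_mul (d i)).mul_const (ω i)).div_const 2).congr_deriv ?_
    ring

lemma gap_form_pos (hn : 1 ≤ n) (ha : ∀ i ≤ n, 0 < a i)
    (hξ : ∀ i, 1 ≤ i → i < n → ξ i < ξ (i + 1)) {i : ℕ} (hi : i ≤ n)
    (hω : i ≠ 0 ∧ ω i ≠ 0 ∨ i ≠ n ∧ ω (i + 1) ≠ 0) :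
    gap n a ξ i ^ 2 / 4 * ((if i = 0 then 0 else if 0 ≤ ξ i then (ω i / a i) ^ 2 else 0) +
        (if i = n then 0 else if ξ (i + 1) < 0 then (ω (i + 1) / a i) ^ 2 else 0)) <
      gapDeriv n a ξ ω i * gapDeriv n a ξ ω i - gapDeriv2 n a ξ ω i * gap n a ξ i := by
  have hai := ha i hi
  have hx : (0 ≤ ξ i) = (0 ≤ ξ i / a i) := by
    rw [le_div_iff₀ hai, zero_mul]
  have hy : (ξ (i + 1) < 0) = (ξ (i + 1) / a i < 0) := by
    rw [div_lt_iff₀ hai, zero_mul]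
  have hdiv : ∀ j, ω j ≠ 0 → ω j / a i ≠ 0 := fun j hj => div_ne_zero hj hai.ne'
  unfold gap gapDeriv gapDeriv2
  simp only [hx, hy]
  rcases eq_or_ne i n with h1 | h1
  · have h0 : i ≠ 0 := by omega
    simp only [h1.symm, h0, if_true, if_false, ne_eq, not_true, false_and, or_false] at hω ⊢
    refine lt_of_eq_of_lt ?_ (lt_of_lt_of_eq (tail_form_pos (ξ i / a i) (hdiv i hω.2)) ?_) <;> ring
  rcases eq_or_ne i 0 with h0 | h0
  · have h1' : 0 ≠ n := by omega
    subst h0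
    simp only [h1', if_true, if_false, ne_eq, not_true, false_and, false_or] at hω ⊢
    refine lt_of_eq_of_lt ?_
      (lt_of_lt_of_eq (head_form_pos (ξ (0 + 1) / a 0) (hdiv _ hω.2)) ?_) <;> ring
  · simp only [h0, h1, if_false]
    refine lt_of_lt_of_eq (form_pos
      (div_lt_div_of_pos_right (hξ i (by omega) (by omega)) hai)
      (hω.imp (fun h => hdiv _ h.2) fun h => hdiv _ h.2)) ?_
    ring

lemma sum_Icc_eq_sum_range (f : ℕ → ℝ) (n : ℕ) :
    ∑ i ∈ Finset.Icc 1 n, f i = ∑ i ∈ Finset.range n, f (i + 1) := by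
  rw [Finset.range_eq_Ico, Finset.sum_Ico_add' f 0 n 1]
  rfl

lemma sum_range_ite_zero (f : ℕ → ℝ) (n : ℕ) :
    ∑ i ∈ Finset.range (n + 1), (if i = 0 then 0 else f i) = ∑ i ∈ Finset.Icc 1 n, f i := by
  rw [sum_Icc_eq_sum_range, Finset.sum_range_succ']
  simp

lemma sum_range_ite_last (f : ℕ → ℝ) (n : ℕ) :
    ∑ i ∈ Finset.range (n + 1), (if i = n then 0 else f (i + 1))
      = ∑ i ∈ Finset.Icc 1 n, f i := by
  rw [sum_Icc_eq_sum_range, Finset.sum_range_succ, if_pos rfl, add_zero]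
  refine Finset.sum_congr rfl fun i hi => if_neg ?_
  have := Finset.mem_range.1 hi
  omega

lemma dirDeriv2_pos (hn : 1 ≤ n)
    (hu : ∀ i ≤ n, u i < u (i + 1)) (ha : ∀ i ≤ n, 0 < a i) (hk : ∀ i ≤ n, 0 < k i)
    (hconv : ∀ i, 1 ≤ i → i ≤ n →
      0 ≤ min (k i / a i ^ 2 * (u (i + 1) - u i))
            (k (i - 1) / a (i - 1) ^ 2 * (u i - u (i - 1))) + 2 * d i)
    (hξ : ∀ i, 1 ≤ i → i < n → ξ i < ξ (i + 1)) (hω : ∃ i, 1 ≤ i ∧ i ≤ n ∧ ω i ≠ 0) :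
    0 < dirDeriv2 n u a k d ξ ω := by
  let P : ℕ → ℝ := fun i =>
    if 0 ≤ ξ i then k i / a i ^ 2 * (u (i + 1) - u i) / 4 * ω i ^ 2 else 0
  let N : ℕ → ℝ := fun i =>
    if ξ i < 0 then k (i - 1) / a (i - 1) ^ 2 * (u i - u (i - 1)) / 4 * ω i ^ 2 else 0
  let T : ℕ → ℝ := fun i => k i * (u (i + 1) - u i) *
      ((gapDeriv n a ξ ω i * gapDeriv n a ξ ω i - gapDeriv2 n a ξ ω i * gap n a ξ i)
        / gap n a ξ i ^ 2)
  have hstrict : ∀ i ≤ n, (i ≠ 0 ∧ ω i ≠ 0 ∨ i ≠ n ∧ ω (i + 1) ≠ 0) →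
      (if i = 0 then 0 else P i) + (if i = n then 0 else N (i + 1)) < T i := by
    intro i hi hωi
    have hg := gap_pos hn ha hξ hi
    have hc : 0 < k i * (u (i + 1) - u i) := mul_pos (hk i hi) (sub_pos.2 (hu i hi))
    have hai := (ha i hi).ne'
    have h := gap_form_pos hn ha hξ hi hωi
    have h2 := mul_lt_mul_of_pos_left (div_lt_div_of_pos_right h (pow_pos hg 2)) hc
    refine lt_of_eq_of_lt ?_ h2
    rw [mul_div_right_comm, div_right_comm, div_self (pow_pos hg 2).ne', mul_add, mul_add]
    simp only [P, N, Nat.add_sub_cancel]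
    congr 1
    · split_ifs <;> ring
    · split_ifs <;> ring
  have hweak : ∀ i ∈ Finset.range (n + 1),
      (if i = 0 then 0 else P i) + (if i = n then 0 else N (i + 1)) ≤ T i := by
    intro i hi
    by_cases hωi : i ≠ 0 ∧ ω i ≠ 0 ∨ i ≠ n ∧ ω (i + 1) ≠ 0
    · exact (hstrict i (Nat.lt_succ_iff.1 (Finset.mem_range.1 hi)) hωi).le
    · push Not at hωi
      have hP : (if i = 0 then 0 else P i) = 0 := by
        split_ifs with h
        · rfl
        · simp [P, hωi.1 h]
      have hN : (if i = n then 0 else N (i + 1)) = 0 := by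
        split_ifs with h
        · rfl
        · simp [N, hωi.2 h]
      have h1 : gapDeriv n a ξ ω i = 0 := by
        refine (congrArg₂ (· - ·) (ite_eq_left_iff.2 fun h => ?_)
          (ite_eq_left_iff.2 fun h => ?_)).trans (sub_zero 0)
        · simp [hωi.2 h]
        · simp [hωi.1 h]
      have h2 : gapDeriv2 n a ξ ω i = 0 := by
        refine (congrArg₂ (· - ·) (ite_eq_left_iff.2 fun h => ?_)
          (ite_eq_left_iff.2 fun h => ?_)).trans (sub_zero 0)
        · simp [hωi.2 h]
        · simp [hωi.1 h]
      simp [hP, hN, T, h1, h2]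
  have hsum : ∑ i ∈ Finset.Icc 1 n, (P i + N i) < ∑ i ∈ Finset.range (n + 1), T i := by
    rw [Finset.sum_add_distrib, ← sum_range_ite_zero, ← sum_range_ite_last N,
      ← Finset.sum_add_distrib]
    obtain ⟨i, hi1, hin, hi⟩ := hω
    exact Finset.sum_lt_sum hweak ⟨i, Finset.mem_range.2 (by omega),
      hstrict i hin (Or.inl ⟨by omega, hi⟩)⟩
  have hd : 0 ≤ ∑ i ∈ Finset.Icc 1 n, (P i + N i + d i * ω i ^ 2 / 2) := by
    refine Finset.sum_nonneg fun i hi => ?_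
    obtain ⟨hi1, hin⟩ := Finset.mem_Icc.1 hi
    have h := hconv i hi1 hin
    have hmin1 := min_le_left (k i / a i ^ 2 * (u (i + 1) - u i))
      (k (i - 1) / a (i - 1) ^ 2 * (u i - u (i - 1)))
    have hmin2 := min_le_right (k i / a i ^ 2 * (u (i + 1) - u i))
      (k (i - 1) / a (i - 1) ^ 2 * (u i - u (i - 1)))
    have hsq := sq_nonneg (ω i)
    simp only [P, N]
    rcases le_or_gt 0 (ξ i) with hx | hx
    · rw [if_pos hx, if_neg hx.not_gt]
      nlinarith
    · rw [if_neg hx.not_ge, if_pos hx]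
      nlinarith
  rw [Finset.sum_add_distrib] at hd
  have heq : dirDeriv2 n u a k d ξ ω
      = ∑ i ∈ Finset.range (n + 1), T i + ∑ i ∈ Finset.Icc 1 n, d i * ω i ^ 2 / 2 := by
    unfold dirDeriv2
    rw [← Finset.sum_neg_distrib]
    congr 1
    refine Finset.sum_congr rfl fun i _ => ?_
    simp only [T]
    ring
  linarith

end Lines

section EuclideanSpace

variable {n : ℕ}

lemma toSeq_add_smul (x v : EuclideanSpace ℝ (Fin n)) (t : ℝ) :
    toSeq n (x + t • v) = fun j => toSeq n x j + t * toSeq n v j := by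
  ext j
  unfold toSeq
  split_ifs <;> simp

lemma toSeq_lt_toSeq_succ {x : EuclideanSpace ℝ (Fin n)} (hx : ∀ i j : Fin n, i < j → x i < x j)
    (i : ℕ) (hi1 : 1 ≤ i) (hin : i < n) : toSeq n x i < toSeq n x (i + 1) := by
  unfold toSeq
  rw [dif_pos (by omega), dif_pos (by omega)]
  exact hx _ _ (Fin.mk_lt_mk.2 (by omega))

lemma exists_toSeq_ne_zero {v : EuclideanSpace ℝ (Fin n)} (hv : v ≠ 0) :
    ∃ i, 1 ≤ i ∧ i ≤ n ∧ toSeq n v i ≠ 0 := by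
  by_contra! h
  refine hv (PiLp.ext fun i => ?_)
  have h2 := h (i + 1) (by omega) (by omega)
  unfold toSeq at h2
  rw [dif_pos (by simp)] at h2
  simpa using h2

lemma convex_strictlyOrdered :
    Convex ℝ {x : EuclideanSpace ℝ (Fin n) | ∀ i j : Fin n, i < j → x i < x j} := by
  intro x hx y hy b c hb hc hbc i j hij
  have h1 := hx i j hij
  have h2 := hy i j hij
  simp only [PiLp.add_apply, PiLp.smul_apply, smul_eq_mul]
  rcases hb.eq_or_lt with rfl | hb
  · simp only [zero_add] at hbc
    simpa [hbc] using h2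
  · nlinarith

lemma isOpen_strictlyOrdered :
    IsOpen {x : EuclideanSpace ℝ (Fin n) | ∀ i j : Fin n, i < j → x i < x j} := by
  simp only [Set.ofPred_forall]
  refine isOpen_iInter_of_finite fun i => isOpen_iInter_of_finite fun j =>
    isOpen_iInter_of_finite fun _ => isOpen_lt ?_ ?_ <;> fun_prop

lemma contDiff_F : ContDiff ℝ 2 F := by
  have h1 : deriv F = F' := funext fun x => (hasDerivAt_F x).deriv
  have h2 : ContDiff ℝ 1 F' := by
    unfold F'
    fun_prop
  rw [show (2 : WithTop ℕ∞) = 1 + 1 by norm_num, contDiff_succ_iff_deriv, h1]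
  exact ⟨fun x => (hasDerivAt_F x).differentiableAt, by simp, h2⟩

lemma contDiff_toSeq (i : ℕ) :
    ContDiff ℝ 2 fun x : EuclideanSpace ℝ (Fin n) => toSeq n x i := by
  unfold toSeq
  split_ifs
  · fun_prop
  · fun_prop

lemma contDiffAt_E (hn : 1 ≤ n) {u a k d : ℕ → ℝ} (ha : ∀ i ≤ n, 0 < a i)
    {x : EuclideanSpace ℝ (Fin n)} (hx : ∀ i j : Fin n, i < j → x i < x j) :
    ContDiffAt ℝ 2 (fun y => E n u a k d (toSeq n y)) x := by
  have hF : ∀ i j, ContDiff ℝ 2 fun y : EuclideanSpace ℝ (Fin n) => F (toSeq n y j / a i) :=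
    fun i j => contDiff_F.comp ((contDiff_toSeq j).div_const (a i))
  refine ContDiffAt.add (ContDiffAt.neg (ContDiffAt.sum fun i hi => ?_))
    (ContDiffAt.sum fun i _ => ?_)
  · refine contDiffAt_const.mul (ContDiffAt.log (ContDiff.contDiffAt ?_)
      (gap_pos hn ha (toSeq_lt_toSeq_succ hx) (Nat.lt_succ_iff.1 (Finset.mem_range.1 hi))).ne')
    refine ContDiff.sub ?_ ?_
    · split_ifs
      · exact contDiff_const
      · exact hF _ _
    · split_ifs
      · exact contDiff_const
      · exact hF _ _
  · exact ((contDiff_const.mul ((contDiff_toSeq i).pow 2)).div_const 4).contDiffAt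

lemma iteratedFDeriv_two_eq_of_hasDerivAt {V : Type*} [NormedAddCommGroup V] [NormedSpace ℝ V]
    {f : V → ℝ} {x v : V} (hf : ContDiffAt ℝ 2 f x) {g : ℝ → ℝ} {c : ℝ}
    (hg : ∀ᶠ t in nhds (0 : ℝ), HasDerivAt (fun t : ℝ => f (x + t • v)) (g t) t)
    (hc : HasDerivAt g c 0) : iteratedFDeriv ℝ 2 f x ![v, v] = c := by
  have hline : ∀ t : ℝ, HasDerivAt (fun t : ℝ => x + t • v) v t := fun t => by
    simpa using ((hasDerivAt_id t).smul_const v).const_add x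
  have hcont : Tendsto (fun t : ℝ => x + t • v) (nhds 0) (nhds x) := by
    simpa using (hline 0).continuousAt.tendsto
  have hdiff : ∀ᶠ y in nhds x, DifferentiableAt ℝ f y :=
    (hf.eventually (by simp)).mono fun y hy => hy.differentiableAt (by norm_num)
  have heq : g =ᶠ[nhds 0] fun t => fderiv ℝ f (x + t • v) v := by
    filter_upwards [hg, hcont.eventually hdiff] with t h1 h2
    exact h1.unique (h2.hasFDerivAt.comp_hasDerivAt t (hline t))
  have hf2 : DifferentiableAt ℝ (fderiv ℝ f) x :=
    (hf.fderiv_right (m := 1) (by norm_num)).differentiableAt (by norm_num)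
  have h0 : x + (0 : ℝ) • v = x := by simp
  have hd : HasDerivAt (fun t : ℝ => fderiv ℝ f (x + t • v)) (fderiv ℝ (fderiv ℝ f) x v) 0 := by
    refine HasFDerivAt.comp_hasDerivAt (f := fun t : ℝ => x + t • v) 0 ?_ (hline 0)
    rw [h0]
    exact hf2.hasFDerivAt
  have hd2 : HasDerivAt (fun t : ℝ => fderiv ℝ f (x + t • v) v)
      (fderiv ℝ (fderiv ℝ f) x v v) 0 := by
    simpa using hd.clm_apply (hasDerivAt_const (0 : ℝ) v)
  rw [iteratedFDeriv_two_apply]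
  exact (hd2.congr_of_eventuallyEq heq).unique hc

end EuclideanSpace

/-- If `min(κ_i(u_{i+1}−u_i), κ_{i−1}(u_i−u_{i−1})) + 2d_i ≥ 0` for all `i = 1,…,n`, then `E`
is strictly convex on `Ω`; in fact its Hessian is positive definite at every point of `Ω`. -/
theorem stmt15 (n : ℕ) (hn : 1 ≤ n) (u a k d : ℕ → ℝ)
    (hu : ∀ i ≤ n, u i < u (i + 1))
    (ha : ∀ i ≤ n, 0 < a i)
    (hk : ∀ i ≤ n, 0 < k i)
    (hconv : ∀ i, 1 ≤ i → i ≤ n →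
      0 ≤ min (k i / a i ^ 2 * (u (i + 1) - u i))
            (k (i - 1) / a (i - 1) ^ 2 * (u i - u (i - 1))) + 2 * d i) :
    StrictConvexOn ℝ {x : EuclideanSpace ℝ (Fin n) | ∀ i j : Fin n, i < j → x i < x j}
      (fun x => E n u a k d (toSeq n x)) ∧
    ∀ x ∈ {x : EuclideanSpace ℝ (Fin n) | ∀ i j : Fin n, i < j → x i < x j},
      ∀ v : EuclideanSpace ℝ (Fin n), v ≠ 0 →
        0 < iteratedFDeriv ℝ 2 (fun y => E n u a k d (toSeq n y)) x ![v, v] := by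
  set Ω := {x : EuclideanSpace ℝ (Fin n) | ∀ i j : Fin n, i < j → x i < x j}
  have hD1 : ∀ (x v : EuclideanSpace ℝ (Fin n)) (t : ℝ), x + t • v ∈ Ω →
      HasDerivAt (fun t : ℝ => E n u a k d (toSeq n (x + t • v)))
        (dirDeriv n u a k d (fun j => toSeq n x j + t * toSeq n v j) (toSeq n v)) t := by
    intro x v t h
    have h1 := toSeq_lt_toSeq_succ h
    simp only [toSeq_add_smul] at h1 ⊢
    exact hasDerivAt_E hn ha h1
  have hD2 : ∀ (x v : EuclideanSpace ℝ (Fin n)) (t : ℝ), x + t • v ∈ Ω →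
      HasDerivAt (fun t : ℝ => dirDeriv n u a k d
          (fun j => toSeq n x j + t * toSeq n v j) (toSeq n v))
        (dirDeriv2 n u a k d (fun j => toSeq n x j + t * toSeq n v j) (toSeq n v)) t := by
    intro x v t h
    have h1 := toSeq_lt_toSeq_succ h
    simp only [toSeq_add_smul] at h1
    exact hasDerivAt_dirDeriv hn ha h1
  have hpos : ∀ (x v : EuclideanSpace ℝ (Fin n)) (t : ℝ), x + t • v ∈ Ω → v ≠ 0 →
      0 < dirDeriv2 n u a k d (fun j => toSeq n x j + t * toSeq n v j) (toSeq n v) := by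
    intro x v t h hv
    have h1 := toSeq_lt_toSeq_succ h
    simp only [toSeq_add_smul] at h1
    exact dirDeriv2_pos hn hu ha hk hconv h1 (exists_toSeq_ne_zero hv)
  refine ⟨⟨convex_strictlyOrdered, ?_⟩, ?_⟩
  · intro x hx y hy hxy b c hb hc hbc
    have hmem : ∀ t ∈ Set.Icc (0 : ℝ) 1, x + t • (y - x) ∈ Ω := fun t ht =>
      convex_strictlyOrdered.add_smul_sub_mem hx hy ht
    have hv : y - x ≠ 0 := sub_ne_zero.2 hxy.symm
    have hderiv : ∀ t ∈ interior (Set.Icc (0 : ℝ) 1),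
        deriv (fun t : ℝ => E n u a k d (toSeq n (x + t • (y - x)))) t = _ := fun t ht =>
      (hD1 x (y - x) t (hmem t (interior_subset ht))).deriv
    have hconvex : StrictConvexOn ℝ (Set.Icc (0 : ℝ) 1)
        fun t : ℝ => E n u a k d (toSeq n (x + t • (y - x))) := by
      refine StrictMonoOn.strictConvexOn_of_deriv (convex_Icc 0 1)
        (fun t ht => (hD1 x (y - x) t (hmem t ht)).continuousAt.continuousWithinAt) ?_
      refine StrictMonoOn.congr ?_ fun t ht => (hderiv t ht).symm
      refine (strictMonoOn_of_deriv_pos (convex_Icc 0 1)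
        (fun t ht => (hD2 x (y - x) t (hmem t ht)).continuousAt.continuousWithinAt)
        fun t ht => ?_).mono interior_subset
      have hm := hmem t (interior_subset ht)
      rw [(hD2 x (y - x) t hm).deriv]
      exact hpos x (y - x) t hm hv
    have h := hconvex.2 (Set.left_mem_Icc.2 zero_le_one) (Set.right_mem_Icc.2 zero_le_one)
      zero_ne_one hb hc hbc
    have hpt : x + (b • (0 : ℝ) + c • (1 : ℝ)) • (y - x) = b • x + c • y := by
      rw [← eq_sub_iff_add_eq] at hbc
      rw [hbc]
      module
    simpa only [hpt, zero_smul, one_smul, add_zero, add_sub_cancel] using h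
  · intro x hx v hv
    have h0 : x + (0 : ℝ) • v = x := by simp
    have hcont : Tendsto (fun t : ℝ => x + t • v) (nhds 0) (nhds x) := by
      have : Continuous fun t : ℝ => x + t • v := by fun_prop
      simpa only [h0] using this.tendsto 0
    have hev : ∀ᶠ t in nhds (0 : ℝ), x + t • v ∈ Ω :=
      hcont.eventually (isOpen_strictlyOrdered.mem_nhds hx)
    rw [iteratedFDeriv_two_eq_of_hasDerivAt (contDiffAt_E hn ha hx)
      (hev.mono fun t ht => hD1 x v t ht) (hD2 x v 0 (h0.symm ▸ hx))]
    exact hpos x v 0 (h0.symm ▸ hx) hv
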